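/- Let α > 0, let 𝔨_α be the Lie algebra on ℝ⁷ with structure equations de¹ = −α e¹⁷, de² = −2 e³⁵, de³ = −e²⁵ − e⁵⁷, de⁴ = (α/2) e⁴⁷ − e⁶⁷, de⁵ = e²³ + e³⁷, de⁶ = e⁴⁷ + (α/2) e⁶⁷, de⁷ = 0, and let φ_α = (α/2)(e¹²⁷ + e³⁴⁷ + e⁵⁶⁷) + e¹³⁵ − e¹⁴⁶ − e²³⁶ − e²⁴⁵ with induced metric g_{φ_α} = Σ_{i=1}^{6} (e^i)² + (α²/4)(e⁷)² and volume form dV_{φ_α} = (α/2) e¹²³⁴⁵⁶⁷. Let ψ_α be the unique 4-form on ℝ⁷ such that β ∧ ψ_α = ⟨β, φ_α⟩_{g_{φ_α}} dV_{φ_α} for every 3-form β (i.e., ψ_α = *_{φ_α}φ_α). Then dψ_α = τ_α ∧ φ_α, where τ_α = 4 e¹² − 2 e³⁴ − 2 e⁵⁶; that is, τ_α is the intrinsic torsion form of the closed G₂-structure φ_α. -/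

import Mathlib

/-!
Common framework: unbundled exterior forms on ℝ⁷, wedge product, interior product,
Chevalley–Eilenberg differential of a Lie bracket, induced inner products on forms,
derived series, and the Lie algebras / G₂-structures from the paper
"Laplacian flow solitons on non-solvable Lie groups" (Fino–Raffero).
-/

open scoped BigOperators

namespace G2Solitons

/-- The underlying vector space ℝ⁷. -/
abbrev V7 : Type := Fin 7 → ℝ

/-- Unbundled `k`-forms: real-valued functions of `k` vectors of ℝ⁷. -/
abbrev Form (k : ℕ) : Type := (Fin k → V7) → ℝ

/-- Standard basis of ℝ⁷. -/
def stdB (i : Fin 7) : V7 := fun j => if j = i then 1 else 0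

/-- The basic `k`-form `e^{i₁} ∧ ⋯ ∧ e^{i_k}` (determinant convention, 0-indexed). -/
def eB {k : ℕ} (idx : Fin k → Fin 7) : Form k :=
  fun v => Matrix.det (Matrix.of fun a b : Fin k => v a (idx b))

/-- Wedge product of a `p`-form and a `q`-form (convention
`(α∧β)(v) = (p!q!)⁻¹ ∑_σ sgn σ · α(v∘σ|_{first p}) β(v∘σ|_{last q})`). -/
noncomputable def wedge {p q : ℕ} (α : Form p) (β : Form q) : Form (p + q) := fun v =>
  ((p.factorial * q.factorial : ℕ) : ℝ)⁻¹ *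
    ∑ σ : Equiv.Perm (Fin (p + q)),
      ((Equiv.Perm.sign σ : ℤ) : ℝ) *
        (α (fun i => v (σ (Fin.castAdd q i))) * β (fun j => v (σ (Fin.natAdd p j))))

/-- Interior product of a vector with a `(k+1)`-form. -/
def iprod {k : ℕ} (u : V7) (α : Form (k + 1)) : Form k := fun v => α (Fin.cons u v)

/-- Chevalley–Eilenberg differential of a `(k+1)`-form with respect to a bracket:
`(dα)(x₀,…,x_{k+1}) = ∑_{i<j} (-1)^{i+j} α([xᵢ,xⱼ], x₀,…,x̂ᵢ,…,x̂ⱼ,…,x_{k+1})`. -/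
def dCE {k : ℕ} (br : V7 → V7 → V7) (α : Form (k + 1)) : Form (k + 2) := fun v =>
  ∑ i : Fin (k + 2), ∑ j : Fin (k + 2),
    if (i : ℕ) < (j : ℕ) then
      (-1 : ℝ) ^ ((i : ℕ) + (j : ℕ)) *
        α (Fin.cons (br (v i) (v j)) fun l : Fin k =>
            if (l : ℕ) < (i : ℕ) then v ⟨(l : ℕ), by omega⟩
            else if (l : ℕ) + 1 < (j : ℕ) then v ⟨(l : ℕ) + 1, by omega⟩
            else v ⟨(l : ℕ) + 2, by omega⟩)
    else 0

/-- Inner product on `k`-forms induced by the diagonal metric `g = ∑ᵢ c i (e^i)²`,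
determined by declaring `{(c i₁ ⋯ c i_k)^{-1/2} e^{i₁⋯i_k} : i₁ < ⋯ < i_k}` orthonormal. -/
noncomputable def formInner (c : Fin 7 → ℝ) {k : ℕ} (α β : Form k) : ℝ :=
  ((k.factorial : ℕ) : ℝ)⁻¹ *
    ∑ f : Fin k → Fin 7,
      (∏ i, c (f i))⁻¹ * (α (fun i => stdB (f i)) * β (fun i => stdB (f i)))

/-- Natural action of an endomorphism `D` on a `k`-form:
`(D.α)(v₁,…,v_k) = ∑ᵢ α(v₁,…,D vᵢ,…,v_k)`. -/
def actD {k : ℕ} (D : V7 → V7) (α : Form k) : Form k := fun v =>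
  ∑ i : Fin k, α (Function.update v i (D (v i)))

/-- The Jacobi identity for a bilinear bracket. -/
def Jacobi (br : V7 → V7 → V7) : Prop :=
  ∀ x y z : V7, br (br x y) z + br (br y z) x + br (br z x) y = 0

/-- Unimodularity: `tr (ad x) = 0` for all `x`. -/
def Unimodular (br : V7 → V7 → V7) : Prop :=
  ∀ x : V7, ∑ i : Fin 7, br x (stdB i) i = 0

/-- Derivation property for a map `D`. -/
def IsDeriv (br : V7 → V7 → V7) (D : V7 → V7) : Prop :=
  ∀ x y : V7, D (br x y) = br (D x) y + br x (D y)

/-- Derived series of a bracket. -/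
def derSeries (br : V7 → V7 → V7) : ℕ → Submodule ℝ V7
  | 0 => ⊤
  | n + 1 => Submodule.span ℝ
      {z | ∃ x ∈ derSeries br n, ∃ y ∈ derSeries br n, z = br x y}

/-- Solvability: the derived series terminates at zero. -/
def Solvable (br : V7 → V7 → V7) : Prop := ∃ n, derSeries br n = ⊥

/-- Real cube root (the real root, also for negative arguments). -/
noncomputable def cbrt (x : ℝ) : ℝ :=
  if x < 0 then -((-x) ^ ((1 : ℝ) / 3)) else x ^ ((1 : ℝ) / 3)

/-- The standard volume form `e^{1234567}`. -/
def vol7 : Form 7 := eB ![0, 1, 2, 3, 4, 5, 6]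

end G2Solitons

namespace G2Solitons

noncomputable section

/-- The bracket of the Lie algebra `𝔨_α` with structure equations
`(-α e¹⁷, -2 e³⁵, -e²⁵ - e⁵⁷, (α/2) e⁴⁷ - e⁶⁷, e²³ + e³⁷, e⁴⁷ + (α/2) e⁶⁷, 0)`,
via the convention `dβ(x,y) = -β([x,y])`. -/
def brK (α : ℝ) : V7 → V7 → V7 := fun x y =>
  ![α * (x 0 * y 6 - x 6 * y 0),
    2 * (x 2 * y 4 - x 4 * y 2),
    (x 1 * y 4 - x 4 * y 1) + (x 4 * y 6 - x 6 * y 4),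
    -(α / 2) * (x 3 * y 6 - x 6 * y 3) + (x 5 * y 6 - x 6 * y 5),
    -(x 1 * y 2 - x 2 * y 1) - (x 2 * y 6 - x 6 * y 2),
    -(x 3 * y 6 - x 6 * y 3) - α / 2 * (x 5 * y 6 - x 6 * y 5),
    0]

/-- `φ_α = (α/2)(e¹²⁷ + e³⁴⁷ + e⁵⁶⁷) + e¹³⁵ - e¹⁴⁶ - e²³⁶ - e²⁴⁵`. -/
def phiK (α : ℝ) : Form 3 := fun v =>
  α / 2 * (eB ![0, 1, 6] v + eB ![2, 3, 6] v + eB ![4, 5, 6] v)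
    + eB ![0, 2, 4] v - eB ![0, 3, 5] v - eB ![1, 2, 5] v - eB ![1, 3, 4] v

/-- Diagonal coefficients of the metric `g_{φ_α} = ∑_{i=1}^{6} (e^i)² + (α²/4)(e⁷)²`. -/
def cK (α : ℝ) : Fin 7 → ℝ := ![1, 1, 1, 1, 1, 1, α ^ 2 / 4]

/-- The metric `g_{φ_α}` as a bilinear form. -/
def gK (α : ℝ) (u v : V7) : ℝ := ∑ i : Fin 7, cK α i * u i * v i

/-- The volume form `dV_{φ_α} = (α/2) e¹²³⁴⁵⁶⁷`. -/
def dVK (α : ℝ) : Form 7 := fun v => α / 2 * vol7 v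

/-- `τ_α = 4 e¹² - 2 e³⁴ - 2 e⁵⁶`. -/
def tauK : Form 2 := fun v =>
  4 * eB ![0, 1] v - 2 * eB ![2, 3] v - 2 * eB ![4, 5] v

/-- `D = diag(-2, 0, 0, 4, 0, 4, 0)`. -/
def DK : V7 → V7 := fun x i => (![-2, 0, 0, 4, 0, 4, 0] : Fin 7 → ℝ) i * x i

end

end G2Solitons

namespace G2Solitons

section BlockPermutations

variable {p q : ℕ}

/-- The permutation of `Fin (p + q)` acting by `π` on the first `p` indices and by `ρ` on the
last `q` indices. -/
def blockPerm (π : Equiv.Perm (Fin p)) (ρ : Equiv.Perm (Fin q)) : Equiv.Perm (Fin (p + q)) :=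
  finSumFinEquiv.permCongr (Equiv.Perm.sumCongr π ρ)

@[simp]
theorem blockPerm_castAdd (π : Equiv.Perm (Fin p)) (ρ : Equiv.Perm (Fin q)) (i : Fin p) :
    blockPerm π ρ (Fin.castAdd q i) = Fin.castAdd q (π i) := by
  simp [blockPerm, Equiv.permCongr_apply]

@[simp]
theorem blockPerm_natAdd (π : Equiv.Perm (Fin p)) (ρ : Equiv.Perm (Fin q)) (j : Fin q) :
    blockPerm π ρ (Fin.natAdd p j) = Fin.natAdd p (ρ j) := by
  simp [blockPerm, Equiv.permCongr_apply]

@[simp]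
theorem sign_blockPerm (π : Equiv.Perm (Fin p)) (ρ : Equiv.Perm (Fin q)) :
    Equiv.Perm.sign (blockPerm π ρ) = Equiv.Perm.sign π * Equiv.Perm.sign ρ := by
  simp [blockPerm]

theorem blockPerm_injective :
    Function.Injective fun x : Equiv.Perm (Fin p) × Equiv.Perm (Fin q) => blockPerm x.1 x.2 := by
  intro x y h
  ext i
  · have := congrArg (fun σ : Equiv.Perm (Fin (p + q)) => (σ (Fin.castAdd q i) : ℕ)) h
    simpa using this
  · have := congrArg (fun σ : Equiv.Perm (Fin (p + q)) => (σ (Fin.natAdd p i) : ℕ)) h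
    simpa using this

theorem exists_blockPerm_eq (σ : Equiv.Perm (Fin (p + q)))
    (hσ : ∀ i : Fin p, (σ (Fin.castAdd q i) : ℕ) < p) :
    ∃ (π : Equiv.Perm (Fin p)) (ρ : Equiv.Perm (Fin q)), blockPerm π ρ = σ := by
  have h : Set.MapsTo (finSumFinEquiv.symm.permCongr σ) (Set.range Sum.inl) (Set.range Sum.inl) := by
    rintro _ ⟨i, rfl⟩
    refine ⟨⟨_, hσ i⟩, ?_⟩
    rw [Equiv.permCongr_apply, Equiv.symm_symm, finSumFinEquiv_apply_left, Equiv.eq_symm_apply]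
    rfl
  obtain ⟨⟨π, ρ⟩, hx⟩ := Equiv.Perm.mem_sumCongrHom_range_of_perm_mapsTo_inl h
  refine ⟨π, ρ, ?_⟩
  rw [blockPerm, show Equiv.Perm.sumCongr π ρ = _ from hx]
  ext
  simp [Equiv.permCongr_apply]

end BlockPermutations

section Wedge

variable {p q : ℕ}

/-- If the first factor vanishes on all tuples meeting the last `q` vectors, only the identity
shuffle contributes to a wedge product. -/
theorem wedge_apply_of_forall_eq_zero (β : AlternatingMap ℝ V7 ℝ (Fin p))
    (ψ : AlternatingMap ℝ V7 ℝ (Fin q)) (w : Fin (p + q) → V7)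
    (h : ∀ f : Fin p → Fin (p + q), (∃ i, p ≤ (f i : ℕ)) → β (fun i => w (f i)) = 0) :
    wedge β ψ w = β (fun i => w (Fin.castAdd q i)) * ψ (fun j => w (Fin.natAdd p j)) := by
  have key : ∑ σ : Equiv.Perm (Fin (p + q)), ((Equiv.Perm.sign σ : ℤ) : ℝ) *
        (β (fun i => w (σ (Fin.castAdd q i))) * ψ (fun j => w (σ (Fin.natAdd p j)))) =
      ∑ _x : Equiv.Perm (Fin p) × Equiv.Perm (Fin q),
        β (fun i => w (Fin.castAdd q i)) * ψ (fun j => w (Fin.natAdd p j)) := by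
    symm
    refine Finset.sum_of_injOn (fun x => blockPerm x.1 x.2) blockPerm_injective.injOn
      (by simp) ?_ ?_
    · intro σ _ hσ
      rw [h, zero_mul, mul_zero]
      by_contra! hc
      obtain ⟨π, ρ, rfl⟩ := exists_blockPerm_eq σ hc
      exact hσ ⟨(π, ρ), by simp⟩
    · rintro ⟨π, ρ⟩ -
      have hβ := β.map_perm (fun i => w (Fin.castAdd q i)) π
      have hψ := ψ.map_perm (fun j => w (Fin.natAdd p j)) ρ
      simp only [Function.comp_def] at hβ hψ
      simp only [blockPerm_castAdd, blockPerm_natAdd, sign_blockPerm, hβ, hψ]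
      rcases Int.units_eq_one_or (Equiv.Perm.sign π) with hπ | hπ <;>
        rcases Int.units_eq_one_or (Equiv.Perm.sign ρ) with hρ | hρ <;> simp [hπ, hρ]
  rw [wedge, key]
  simp only [Finset.sum_const, Finset.card_univ, Fintype.card_prod, Fintype.card_perm,
    Fintype.card_fin, nsmul_eq_mul]
  rw [inv_mul_cancel_left₀]
  exact_mod_cast (Nat.mul_pos p.factorial_pos q.factorial_pos).ne'

theorem wedge_eB (I : Fin p → Fin 7) (J : Fin q → Fin 7) (v : Fin (p + q) → V7) :
    wedge (eB I) (eB J) v = eB (Fin.append I J) v := by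
  have key (π : Equiv.Perm (Fin p)) (ρ : Equiv.Perm (Fin q)) :
      ∑ σ : Equiv.Perm (Fin (p + q)), ((Equiv.Perm.sign σ : ℤ) : ℝ) *
        ((((Equiv.Perm.sign π : ℤ) : ℝ) * ∏ i, v (σ (Fin.castAdd q (π i))) (I i)) *
          (((Equiv.Perm.sign ρ : ℤ) : ℝ) * ∏ j, v (σ (Fin.natAdd p (ρ j))) (J j))) =
      eB (Fin.append I J) v := by
    rw [eB, Matrix.det_apply']
    refine Fintype.sum_equiv (Equiv.mulRight (blockPerm π ρ)) _ _ fun σ => ?_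
    simp [Fin.prod_univ_add]
    ring
  simp only [wedge]
  have : ∀ σ : Equiv.Perm (Fin (p + q)), ((Equiv.Perm.sign σ : ℤ) : ℝ) *
      (eB I (fun i => v (σ (Fin.castAdd q i))) * eB J (fun j => v (σ (Fin.natAdd p j)))) =
      ∑ π : Equiv.Perm (Fin p), ∑ ρ : Equiv.Perm (Fin q), ((Equiv.Perm.sign σ : ℤ) : ℝ) *
        ((((Equiv.Perm.sign π : ℤ) : ℝ) * ∏ i, v (σ (Fin.castAdd q (π i))) (I i)) *
          (((Equiv.Perm.sign ρ : ℤ) : ℝ) * ∏ j, v (σ (Fin.natAdd p (ρ j))) (J j))) := by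
    intro σ
    simp only [eB, Matrix.det_apply', Matrix.of_apply, Finset.sum_mul_sum]
    simp only [Finset.mul_sum]
  simp only [this]
  rw [Finset.sum_comm]
  simp_rw [Finset.sum_comm (s := (Finset.univ : Finset (Equiv.Perm (Fin (p + q))))), key]
  simp only [Finset.sum_const, Finset.card_univ, Fintype.card_perm,
    Fintype.card_fin, nsmul_eq_mul, ← mul_assoc]
  rw [mul_assoc (((_ : ℕ) : ℝ)⁻¹), ← Nat.cast_mul, inv_mul_cancel₀, one_mul]
  exact_mod_cast (Nat.mul_pos p.factorial_pos q.factorial_pos).ne'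

theorem wedge_sum_smul {ι κ : Type*} (s : Finset ι) (t : Finset κ) (a : ι → ℝ) (b : κ → ℝ)
    (F : ι → Form p) (G : κ → Form q) (v : Fin (p + q) → V7) :
    wedge (∑ i ∈ s, a i • F i) (∑ j ∈ t, b j • G j) v =
      ∑ i ∈ s, ∑ j ∈ t, a i * b j * wedge (F i) (G j) v := by
  simp only [wedge, Finset.sum_apply, Pi.smul_apply, smul_eq_mul, Finset.sum_mul_sum]
  simp only [Finset.mul_sum]
  rw [Finset.sum_comm]
  refine Finset.sum_congr rfl fun i _ => ?_
  rw [Finset.sum_comm]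
  refine Finset.sum_congr rfl fun j _ => Finset.sum_congr rfl fun σ _ => ?_
  ring

end Wedge

section Basis

variable {k : ℕ}

/-- The basic form `eB idx` as an alternating map. -/
noncomputable def eBAlt (idx : Fin k → Fin 7) : AlternatingMap ℝ V7 ℝ (Fin k) :=
  Matrix.detRowAlternating.compLinearMap (LinearMap.funLeft ℝ ℝ idx)

@[simp]
theorem coe_eBAlt (idx : Fin k → Fin 7) : ⇑(eBAlt idx) = eB idx := rfl

theorem eB_eq_zero_of_forall_ne {idx : Fin k → Fin 7} {v : Fin k → V7} (i : Fin k)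
    (h : ∀ j, v i (idx j) = 0) : eB idx v = 0 :=
  Matrix.det_eq_zero_of_row_eq_zero i h

theorem eB_stdB_comp {n : ℕ} (f g : Fin n → Fin 7) :
    eB f (fun i => stdB (g i)) = ((1 : Matrix (Fin 7) (Fin 7) ℝ).submatrix g f).det := by
  rw [eB]
  congr 1
  ext i j
  simp [stdB, Matrix.one_apply, eq_comm]

theorem eB_stdB_perm (τ κ : Equiv.Perm (Fin 7)) :
    eB τ (fun i => stdB (κ i)) =
      ((Equiv.Perm.sign τ : ℤ) : ℝ) * ((Equiv.Perm.sign κ : ℤ) : ℝ) := by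
  have : (1 : Matrix (Fin 7) (Fin 7) ℝ).submatrix κ τ =
      ((1 : Matrix (Fin 7) (Fin 7) ℝ).submatrix κ id).submatrix id τ := rfl
  rw [eB_stdB_comp, this, Matrix.det_permute', Matrix.det_permute, Matrix.det_one, mul_one]

/-- Complementary minors of an orthogonal matrix agree up to its determinant. -/
theorem det_toBlocks₁₁_of_mul_transpose_eq_one {m n R : Type*} [Fintype m] [Fintype n]
    [DecidableEq m] [DecidableEq n] [CommRing R] (N : Matrix (m ⊕ n) (m ⊕ n) R)
    (h : N * N.transpose = 1) : N.toBlocks₁₁.det = N.det * N.toBlocks₂₂.det := by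
  obtain ⟨A, B, C, D, rfl⟩ : ∃ A B C D, N = Matrix.fromBlocks A B C D :=
    ⟨_, _, _, _, N.fromBlocks_toBlocks.symm⟩
  rw [Matrix.fromBlocks_transpose, Matrix.fromBlocks_multiply, ← Matrix.fromBlocks_one,
    Matrix.fromBlocks_inj] at h
  obtain ⟨-, h₁₂, -, h₂₂⟩ := h
  have key : Matrix.fromBlocks A B C D * Matrix.fromBlocks 1 C.transpose 0 D.transpose =
      Matrix.fromBlocks A 0 C 1 := by
    simp [Matrix.fromBlocks_multiply, h₁₂, h₂₂]
  simpa using (congrArg Matrix.det key).symm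

theorem eB_castAdd_stdB {p q : ℕ} (e : Fin (p + q) ≃ Fin 7) (τ κ : Equiv.Perm (Fin 7)) :
    eB (fun i => τ (e (Fin.castAdd q i))) (fun i => stdB (κ (e (Fin.castAdd q i)))) =
      ((Equiv.Perm.sign τ : ℤ) : ℝ) * ((Equiv.Perm.sign κ : ℤ) : ℝ) *
        eB (fun j => κ (e (Fin.natAdd p j))) (fun j => stdB (τ (e (Fin.natAdd p j)))) := by
  let f : Fin p ⊕ Fin q ≃ Fin 7 := finSumFinEquiv.trans e
  let N := (1 : Matrix (Fin 7) (Fin 7) ℝ).submatrix (f.trans κ) (f.trans τ)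
  have hN : N * N.transpose = 1 := by
    simp only [N, Matrix.transpose_submatrix, Matrix.submatrix_mul_equiv, Matrix.transpose_one,
      mul_one, Matrix.submatrix_one_equiv]
  have hdet : N.det = ((Equiv.Perm.sign τ : ℤ) : ℝ) * ((Equiv.Perm.sign κ : ℤ) : ℝ) := by
    rw [← eB_stdB_perm, eB_stdB_comp, ← Matrix.det_submatrix_equiv_self f]
    rfl
  have h := det_toBlocks₁₁_of_mul_transpose_eq_one N hN
  have hN₂₂ : N.toBlocks₂₂.transpose = (1 : Matrix (Fin 7) (Fin 7) ℝ).submatrix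
      (fun j => τ (e (Fin.natAdd p j))) (fun j => κ (e (Fin.natAdd p j))) := by
    ext i j
    simp [N, f, Matrix.toBlocks₂₂, Matrix.one_apply, eq_comm]
  rw [← Matrix.det_transpose N.toBlocks₂₂, hN₂₂] at h
  rw [← hdet, eB_stdB_comp, eB_stdB_comp, ← h]
  rfl

theorem formInner_sum_smul {ι : Type*} (c : Fin 7 → ℝ) (β : Form k) (s : Finset ι) (a : ι → ℝ)
    (F : ι → Form k) :
    formInner c β (∑ t ∈ s, a t • F t) = ∑ t ∈ s, a t * formInner c β (F t) := by
  simp only [formInner, Finset.sum_apply, Pi.smul_apply, smul_eq_mul, Finset.mul_sum]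
  rw [Finset.sum_comm]
  refine Finset.sum_congr rfl fun t _ => Finset.sum_congr rfl fun f _ => ?_
  ring

theorem formInner_eB (c : Fin 7 → ℝ) (β : AlternatingMap ℝ V7 ℝ (Fin k)) (I : Fin k → Fin 7) :
    formInner c β (eB I) = (∏ i, c (I i))⁻¹ * β (fun i => stdB (I i)) := by
  have key (π : Equiv.Perm (Fin k)) :
      ∑ f : Fin k → Fin 7, (∏ i, c (f i))⁻¹ * (β (fun i => stdB (f i)) *
        (((Equiv.Perm.sign π : ℤ) : ℝ) * ∏ i, stdB (f (π i)) (I i))) =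
      (∏ i, c (I i))⁻¹ * β (fun i => stdB (I i)) := by
    rw [Fintype.sum_eq_single (I ∘ π.symm)]
    · have hβ := β.map_perm (fun i => stdB (I i)) π.symm
      simp only [Function.comp_def] at hβ
      have hc : ∏ i, c (I (π.symm i)) = ∏ i, c (I i) := Equiv.prod_comp π.symm fun i => c (I i)
      simp only [Function.comp_apply, hβ, hc, Equiv.symm_apply_apply, Equiv.Perm.sign_symm]
      rcases Int.units_eq_one_or (Equiv.Perm.sign π) with hπ | hπ <;> simp [hπ, stdB]
    · intro f hf
      obtain ⟨i, hi⟩ : ∃ i, I i ≠ f (π i) := by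
        by_contra! hc
        exact hf (funext fun i => by simp [hc])
      have h0 : stdB (f (π i)) (I i) = 0 := by simp [stdB, hi]
      have hprod : ∏ i, stdB (f (π i)) (I i) = 0 := Finset.prod_eq_zero (Finset.mem_univ i) h0
      simp [hprod]
  have hsum (f : Fin k → Fin 7) : (∏ i, c (f i))⁻¹ *
      (β (fun i => stdB (f i)) * eB I (fun i => stdB (f i))) =
      ∑ π : Equiv.Perm (Fin k), (∏ i, c (f i))⁻¹ * (β (fun i => stdB (f i)) *
        (((Equiv.Perm.sign π : ℤ) : ℝ) * ∏ i, stdB (f (π i)) (I i))) := by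
    simp only [eB, Matrix.det_apply', Matrix.of_apply, Finset.mul_sum]
  rw [formInner]
  simp only [hsum]
  rw [Finset.sum_comm]
  simp only [key, Finset.sum_const, Finset.card_univ, Fintype.card_perm, Fintype.card_fin,
    nsmul_eq_mul]
  rw [inv_mul_cancel_left₀ (by exact_mod_cast k.factorial_ne_zero)]

theorem sum_alternatingMap_apply {ι : Type*} (s : Finset ι)
    (F : ι → AlternatingMap ℝ V7 ℝ (Fin k)) (w : Fin k → V7) :
    (∑ t ∈ s, F t) w = ∑ t ∈ s, F t w := by
  classical
  induction s using Finset.induction_on with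
  | empty => simp
  | insert t s ht ih => simp [Finset.sum_insert ht, ih]

/-- The Hodge star of a 3-form whose components are indexed by permutations of `Fin 7`. -/
theorem hodgeStar_eq_sum {ι : Type*} [Fintype ι] (c : Fin 7 → ℝ) (r : ℝ) (a : ι → ℝ)
    (κ : ι → Equiv.Perm (Fin 7)) (ψ : AlternatingMap ℝ V7 ℝ (Fin 4))
    (hψ : ∀ β : AlternatingMap ℝ V7 ℝ (Fin 3), ∀ w : Fin 7 → V7,
      wedge β ψ w =
        formInner c β (∑ t, a t • eB (fun i : Fin 3 => κ t (Fin.castAdd 4 i))) * (r * vol7 w)) :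
    ⇑ψ = ∑ t, (r * ((Equiv.Perm.sign (κ t) : ℤ) : ℝ) * a t *
      (∏ i : Fin 3, c (κ t (Fin.castAdd 4 i)))⁻¹) •
        eB (fun j : Fin 4 => κ t (Fin.natAdd 3 j)) := by
  have hstd : ⇑(Pi.basisFun ℝ (Fin 7)) = stdB := by
    ext i j
    simp [stdB, Pi.single_apply]
  suffices h : ψ = ∑ t, (r * ((Equiv.Perm.sign (κ t) : ℤ) : ℝ) * a t *
      (∏ i : Fin 3, c (κ t (Fin.castAdd 4 i)))⁻¹) •
        eBAlt (fun j : Fin 4 => κ t (Fin.natAdd 3 j)) by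
    rw [h]
    ext w
    simp [sum_alternatingMap_apply, Finset.sum_apply]
  refine (Pi.basisFun ℝ (Fin 7)).ext_alternating fun u hu => ?_
  obtain ⟨τ, hτ⟩ := Equiv.Perm.exists_extending_pair (Fin.natAdd 3 : Fin 4 → Fin 7) u
    (Fin.natAdd_injective 4 3) hu
  have hvol : vol7 (fun i => stdB (τ i)) = ((Equiv.Perm.sign τ : ℤ) : ℝ) := by
    have : (![0, 1, 2, 3, 4, 5, 6] : Fin 7 → Fin 7) = (1 : Equiv.Perm (Fin 7)) := by decide
    rw [vol7, this, eB_stdB_perm]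
    simp
  have hsq : ((Equiv.Perm.sign τ : ℤ) : ℝ) * ((Equiv.Perm.sign τ : ℤ) : ℝ) = 1 := by
    exact_mod_cast Int.units_coe_mul_self (Equiv.Perm.sign τ)
  have hτψ := hψ (eBAlt fun i => τ (Fin.castAdd 4 i)) (fun i => stdB (τ i))
  rw [wedge_apply_of_forall_eq_zero, formInner_sum_smul, hvol] at hτψ
  · have h1 : eB (fun i => τ (Fin.castAdd 4 i)) (fun i => stdB (τ (Fin.castAdd 4 i))) = 1 := by
      rw [eB_stdB_comp]
      exact (congrArg Matrix.det (Matrix.submatrix_one _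
        (τ.injective.comp (Fin.castAdd_injective 3 4)))).trans Matrix.det_one
    simp only [coe_eBAlt, h1, one_mul, hτ] at hτψ
    simp only [hstd, hτψ, sum_alternatingMap_apply, AlternatingMap.smul_apply, smul_eq_mul,
      coe_eBAlt, Finset.sum_mul]
    refine Finset.sum_congr rfl fun t _ => ?_
    rw [← coe_eBAlt, formInner_eB, coe_eBAlt]
    have hc := eB_castAdd_stdB (p := 3) (q := 4) (Equiv.refl _) τ (κ t)
    simp only [Equiv.refl_apply, hτ] at hc
    rw [hc]
    linear_combination (a t * r * (∏ i : Fin 3, c (κ t (Fin.castAdd 4 i)))⁻¹ *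
      ((Equiv.Perm.sign (κ t) : ℤ) : ℝ) *
        eB (fun j : Fin 4 => κ t (Fin.natAdd 3 j)) (fun j => stdB (u j))) * hsq
  · rintro f ⟨i, hi⟩
    rw [coe_eBAlt]
    refine eB_eq_zero_of_forall_ne i fun j => ?_
    have : (Fin.castAdd 4 j : Fin (3 + 4)) ≠ f i := by
      rintro h
      rw [← h] at hi
      exact absurd hi (by simp)
    simpa [stdB] using this

end Basis

section Differential

variable {k : ℕ}

/-- The wedge product of a 2-form with a `k`-form, up to sign, as a sum over shuffles. -/
def shuffle (ω : V7 → V7 → ℝ) (η : Form k) : Form (k + 2) := fun v =>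
  ∑ i : Fin (k + 2), ∑ j : Fin (k + 2),
    if (i : ℕ) < (j : ℕ) then
      (-1 : ℝ) ^ ((i : ℕ) + (j : ℕ)) *
        (ω (v i) (v j) * η fun l : Fin k =>
            if (l : ℕ) < (i : ℕ) then v ⟨(l : ℕ), by omega⟩
            else if (l : ℕ) + 1 < (j : ℕ) then v ⟨(l : ℕ) + 1, by omega⟩
            else v ⟨(l : ℕ) + 2, by omega⟩)
    else 0

theorem dCE_sum_smul {ι : Type*} (br : V7 → V7 → V7) (s : Finset ι) (a : ι → ℝ)
    (F : ι → Form (k + 1)) (v : Fin (k + 2) → V7) :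
    dCE br (∑ t ∈ s, a t • F t) v = ∑ t ∈ s, a t * dCE br (F t) v := by
  simp only [dCE, Finset.sum_apply, Pi.smul_apply, smul_eq_mul, Finset.mul_sum]
  refine Eq.trans (Finset.sum_congr rfl fun i _ => ?_) Finset.sum_comm
  refine Eq.trans ?_ Finset.sum_comm
  refine Finset.sum_congr rfl fun j _ => ?_
  split_ifs
  · exact Finset.sum_congr rfl fun t _ => by ring
  · simp

theorem shuffle_add (ω ω' : V7 → V7 → ℝ) (η : Form k) (v : Fin (k + 2) → V7) :
    shuffle (fun x y => ω x y + ω' x y) η v = shuffle ω η v + shuffle ω' η v := by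
  simp only [shuffle, ← Finset.sum_add_distrib]
  refine Finset.sum_congr rfl fun i _ => Finset.sum_congr rfl fun j _ => ?_
  split_ifs <;> ring

theorem shuffle_smul (a : ℝ) (ω : V7 → V7 → ℝ) (η : Form k) (v : Fin (k + 2) → V7) :
    shuffle (fun x y => a * ω x y) η v = a * shuffle ω η v := by
  simp only [shuffle, Finset.mul_sum]
  refine Finset.sum_congr rfl fun i _ => Finset.sum_congr rfl fun j _ => ?_
  split_ifs <;> ring

/-- The Leibniz rule for the differential of a basic form. -/
theorem dCE_eB (br : V7 → V7 → V7) (idx : Fin (k + 1) → Fin 7) (v : Fin (k + 2) → V7) :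
    dCE br (eB idx) v = ∑ m : Fin (k + 1), (-1 : ℝ) ^ (m : ℕ) *
      shuffle (fun x y => br x y (idx m)) (eB fun l => idx (m.succAbove l)) v := by
  simp only [dCE, shuffle, Finset.mul_sum]
  refine Eq.trans (Finset.sum_congr rfl fun i _ => ?_) Finset.sum_comm
  refine Eq.trans ?_ Finset.sum_comm
  refine Finset.sum_congr rfl fun j _ => ?_
  split_ifs
  · rw [eB, Matrix.det_succ_row_zero, Finset.mul_sum]
    refine Finset.sum_congr rfl fun m _ => ?_
    simp only [eB, Matrix.of_apply, Fin.cons_zero, Matrix.submatrix, Fin.cons_succ]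
    ring
  · simp

theorem shuffle_eB (p q a b c : Fin 7) (v : Fin 5 → V7) :
    shuffle (fun x y => x p * y q - x q * y p) (eB ![a, b, c]) v = -eB ![p, q, a, b, c] v := by
  simp [shuffle, eB, Fin.sum_univ_succ, Matrix.det_succ_row_zero, Fin.succAbove]
  ring

end Differential

section Expansions

/-- The components of `phiK`, in the order of its seven terms. -/
noncomputable def phiKCoeff (α : ℝ) : Fin 7 → ℝ := ![α / 2, α / 2, α / 2, 1, -1, -1, -1]

/-- Permutations whose first three values index the terms of `phiK`. -/
def phiKPerm : Fin 7 → Equiv.Perm (Fin 7) :=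
  ![⟨![0, 1, 6, 2, 3, 4, 5], ![0, 1, 3, 4, 5, 6, 2], by decide, by decide⟩,
    ⟨![2, 3, 6, 0, 1, 4, 5], ![3, 4, 0, 1, 5, 6, 2], by decide, by decide⟩,
    ⟨![4, 5, 6, 0, 1, 2, 3], ![3, 4, 5, 6, 0, 1, 2], by decide, by decide⟩,
    ⟨![0, 2, 4, 1, 3, 5, 6], ![0, 3, 1, 4, 2, 5, 6], by decide, by decide⟩,
    ⟨![0, 3, 5, 1, 2, 4, 6], ![0, 3, 4, 1, 5, 2, 6], by decide, by decide⟩,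
    ⟨![1, 2, 5, 0, 3, 4, 6], ![3, 0, 1, 4, 5, 2, 6], by decide, by decide⟩,
    ⟨![1, 3, 4, 0, 2, 5, 6], ![3, 0, 4, 1, 2, 5, 6], by decide, by decide⟩]

theorem sign_phiKPerm (t : Fin 7) :
    (Equiv.Perm.sign (phiKPerm t) : ℤ) = ![1, 1, 1, -1, -1, -1, -1] t := by
  revert t
  decide +kernel

theorem phiKPerm_castAdd (t : Fin 7) :
    (fun i : Fin 3 => phiKPerm t (Fin.castAdd 4 i)) =
      (![![0, 1, 6], ![2, 3, 6], ![4, 5, 6], ![0, 2, 4], ![0, 3, 5], ![1, 2, 5], ![1, 3, 4]] :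
        Fin 7 → Fin 3 → Fin 7) t := by
  revert t
  decide

theorem phiKPerm_natAdd (t : Fin 7) :
    (fun j : Fin 4 => phiKPerm t (Fin.natAdd 3 j)) =
      (![![2, 3, 4, 5], ![0, 1, 4, 5], ![0, 1, 2, 3], ![1, 3, 5, 6], ![1, 2, 4, 6],
        ![0, 3, 4, 6], ![0, 2, 5, 6]] : Fin 7 → Fin 4 → Fin 7) t := by
  revert t
  decide

theorem phiK_eq_sum (α : ℝ) :
    phiK α = ∑ t, phiKCoeff α t • eB (fun i : Fin 3 => phiKPerm t (Fin.castAdd 4 i)) := by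
  ext v
  simp only [phiKPerm_castAdd]
  simp [phiK, phiKCoeff, Fin.sum_univ_seven]
  ring

theorem tauK_eq_sum :
    tauK = ∑ t, (![4, -2, -2] : Fin 3 → ℝ) t •
      eB ((![![0, 1], ![2, 3], ![4, 5]] : Fin 3 → Fin 2 → Fin 7) t) := by
  ext v
  simp [tauK, Fin.sum_univ_three]
  ring

end Expansions

section Sorting

variable {k : ℕ}

theorem eB_comp_perm (idx : Fin k → Fin 7) (σ : Equiv.Perm (Fin k)) (v : Fin k → V7) :
    eB (idx ∘ σ) v = ((Equiv.Perm.sign σ : ℤ) : ℝ) * eB idx v :=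
  Matrix.det_permute' σ (Matrix.of fun a b => v a (idx b))

theorem eB_comp_swap (idx : Fin k → Fin 7) {i j : Fin k} (hij : i ≠ j) (v : Fin k → V7) :
    eB (idx ∘ Equiv.swap i j) v = -eB idx v := by
  simp [eB_comp_perm, Equiv.Perm.sign_swap hij]

theorem eB_eq_zero_of_eq {idx : Fin k → Fin 7} {i j : Fin k} (hij : i ≠ j) (h : idx i = idx j)
    (v : Fin k → V7) : eB idx v = 0 :=
  Matrix.det_zero_of_column_eq hij fun a => by simp [h]

variable (a b c d e : Fin 7) (v : Fin 5 → V7)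

theorem eB_five_swap₀ : eB ![a, b, c, d, e] v = -eB ![b, a, c, d, e] v := by
  rw [← eB_comp_swap _ (show (0 : Fin 5) ≠ 1 by decide)]
  congr 1
  ext i
  fin_cases i <;> rfl

theorem eB_five_swap₁ : eB ![a, b, c, d, e] v = -eB ![a, c, b, d, e] v := by
  rw [← eB_comp_swap _ (show (1 : Fin 5) ≠ 2 by decide)]
  congr 1
  ext i
  fin_cases i <;> rfl

theorem eB_five_swap₂ : eB ![a, b, c, d, e] v = -eB ![a, b, d, c, e] v := by
  rw [← eB_comp_swap _ (show (2 : Fin 5) ≠ 3 by decide)]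
  congr 1
  ext i
  fin_cases i <;> rfl

theorem eB_five_swap₃ : eB ![a, b, c, d, e] v = -eB ![a, b, c, e, d] v := by
  rw [← eB_comp_swap _ (show (3 : Fin 5) ≠ 4 by decide)]
  congr 1
  ext i
  fin_cases i <;> rfl

variable {a b c d e}

theorem eB_five_sort₀ (_ : b < a) : eB ![a, b, c, d, e] v = -eB ![b, a, c, d, e] v :=
  eB_five_swap₀ a b c d e v

theorem eB_five_sort₁ (_ : c < b) : eB ![a, b, c, d, e] v = -eB ![a, c, b, d, e] v :=
  eB_five_swap₁ a b c d e v

theorem eB_five_sort₂ (_ : d < c) : eB ![a, b, c, d, e] v = -eB ![a, b, d, c, e] v :=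
  eB_five_swap₂ a b c d e v

theorem eB_five_sort₃ (_ : e < d) : eB ![a, b, c, d, e] v = -eB ![a, b, c, e, d] v :=
  eB_five_swap₃ a b c d e v

theorem eB_five_eq_zero₀ : eB ![a, a, c, d, e] v = 0 :=
  eB_eq_zero_of_eq (show (0 : Fin 5) ≠ 1 by decide) rfl v

theorem eB_five_eq_zero₁ : eB ![a, b, b, d, e] v = 0 :=
  eB_eq_zero_of_eq (show (1 : Fin 5) ≠ 2 by decide) rfl v

theorem eB_five_eq_zero₂ : eB ![a, b, c, c, e] v = 0 :=
  eB_eq_zero_of_eq (show (2 : Fin 5) ≠ 3 by decide) rfl v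

theorem eB_five_eq_zero₃ : eB ![a, b, c, d, d] v = 0 :=
  eB_eq_zero_of_eq (show (3 : Fin 5) ≠ 4 by decide) rfl v

end Sorting

section Torsion

variable (α : ℝ) (a b c d : Fin 7) (v : Fin 5 → V7)

theorem dCE_eB_four (br : V7 → V7 → V7) :
    dCE br (eB ![a, b, c, d]) v =
      shuffle (fun x y => br x y a) (eB ![b, c, d]) v -
        shuffle (fun x y => br x y b) (eB ![a, c, d]) v +
        shuffle (fun x y => br x y c) (eB ![a, b, d]) v -
        shuffle (fun x y => br x y d) (eB ![a, b, c]) v := by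
  have h₀ : (fun l : Fin 3 => ![a, b, c, d] (Fin.succAbove 0 l)) = ![b, c, d] := by
    ext i; fin_cases i <;> rfl
  have h₁ : (fun l : Fin 3 => ![a, b, c, d] (Fin.succAbove 1 l)) = ![a, c, d] := by
    ext i; fin_cases i <;> rfl
  have h₂ : (fun l : Fin 3 => ![a, b, c, d] (Fin.succAbove 2 l)) = ![a, b, d] := by
    ext i; fin_cases i <;> rfl
  have h₃ : (fun l : Fin 3 => ![a, b, c, d] (Fin.succAbove 3 l)) = ![a, b, c] := by
    ext i; fin_cases i <;> rfl
  rw [dCE_eB, Fin.sum_univ_four, h₀, h₁, h₂, h₃]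
  simp
  ring

/-- If `br x y m = r (e^{pq})(x, y) + s (e^{p'q'})(x, y)`, its shuffle product with a basic
3-form is a combination of two basic 5-forms. -/
theorem shuffle_eB_of_eq {ω : V7 → V7 → ℝ} {r s : ℝ} {p q p' q' : Fin 7}
    (h : ∀ x y, ω x y = r * (x p * y q - x q * y p) + s * (x p' * y q' - x q' * y p')) :
    shuffle ω (eB ![a, b, c]) v =
      -(r * eB ![p, q, a, b, c] v + s * eB ![p', q', a, b, c] v) := by
  rw [show ω = _ from funext₂ h, shuffle_add, shuffle_smul, shuffle_smul, shuffle_eB, shuffle_eB]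
  ring

theorem shuffle_brK_zero : shuffle (fun x y => brK α x y 0) (eB ![a, b, c]) v =
    -(α * eB ![0, 6, a, b, c] v) := by
  rw [shuffle_eB_of_eq (r := α) (s := 0) (p := 0) (q := 6) (p' := 0) (q' := 0)
    (h := fun x y => by simp [brK])]
  ring

theorem shuffle_brK_one : shuffle (fun x y => brK α x y 1) (eB ![a, b, c]) v =
    -(2 * eB ![2, 4, a, b, c] v) := by
  rw [shuffle_eB_of_eq (r := 2) (s := 0) (p := 2) (q := 4) (p' := 0) (q' := 0)
    (h := fun x y => by simp [brK])]
  ring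

theorem shuffle_brK_two : shuffle (fun x y => brK α x y 2) (eB ![a, b, c]) v =
    -(1 * eB ![1, 4, a, b, c] v + 1 * eB ![4, 6, a, b, c] v) :=
  shuffle_eB_of_eq _ _ _ _ fun x y => by simp [brK]

theorem shuffle_brK_three : shuffle (fun x y => brK α x y 3) (eB ![a, b, c]) v =
    -(-(α / 2) * eB ![3, 6, a, b, c] v + 1 * eB ![5, 6, a, b, c] v) :=
  shuffle_eB_of_eq _ _ _ _ fun x y => by simp [brK]

theorem shuffle_brK_four : shuffle (fun x y => brK α x y 4) (eB ![a, b, c]) v =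
    -(-1 * eB ![1, 2, a, b, c] v + -1 * eB ![2, 6, a, b, c] v) :=
  shuffle_eB_of_eq _ _ _ _ fun x y => by simp [brK]; ring

theorem shuffle_brK_five : shuffle (fun x y => brK α x y 5) (eB ![a, b, c]) v =
    -(-1 * eB ![3, 6, a, b, c] v + -(α / 2) * eB ![5, 6, a, b, c] v) :=
  shuffle_eB_of_eq _ _ _ _ fun x y => by simp [brK]; ring

theorem shuffle_brK_six : shuffle (fun x y => brK α x y 6) (eB ![a, b, c]) v = 0 := by
  simp [shuffle, brK]

theorem wedge_eB_two_three (p q : Fin 7) :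
    wedge (eB ![p, q]) (eB ![a, b, c]) v = eB ![p, q, a, b, c] v := by
  rw [wedge_eB]
  congr 1
  ext i
  fin_cases i <;> rfl

end Torsion

/-- if `ψ_α = *_{φ_α}φ_α` (characterized by the pairing property),
then `dψ_α = τ_α ∧ φ_α`, i.e. `τ_α` is the intrinsic torsion form of `φ_α`. -/
theorem torsion_K (α : ℝ) (hα : 0 < α)
    (ψ : AlternatingMap ℝ V7 ℝ (Fin 4))
    (hψ : ∀ β : AlternatingMap ℝ V7 ℝ (Fin 3), ∀ w : Fin 7 → V7,
      wedge (⇑β) (⇑ψ) w = formInner (cK α) (⇑β) (phiK α) * dVK α w) :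
    ∀ w, dCE (brK α) (⇑ψ) w = wedge tauK (phiK α) w := by
  intro w
  have hstar := hodgeStar_eq_sum (cK α) (α / 2) (phiKCoeff α) phiKPerm ψ
    fun β w => by rw [hψ, phiK_eq_sum, dVK]
  have hc (t : Fin 7) : ∏ i : Fin 3, cK α (phiKPerm t (Fin.castAdd 4 i)) =
      (![α ^ 2 / 4, α ^ 2 / 4, α ^ 2 / 4, 1, 1, 1, 1] : Fin 7 → ℝ) t := by
    have h (i : Fin 3) := congrFun (phiKPerm_castAdd t) i
    simp only [h]
    fin_cases t <;> simp [cK, Fin.prod_univ_three]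
  rw [hstar, tauK_eq_sum, phiK_eq_sum, dCE_sum_smul, wedge_sum_smul]
  simp only [hc, phiKPerm_castAdd, phiKPerm_natAdd, sign_phiKPerm]
  simp [Fin.sum_univ_seven, Fin.sum_univ_three, phiKCoeff, dCE_eB_four, wedge_eB_two_three,
    shuffle_brK_zero, shuffle_brK_one, shuffle_brK_two, shuffle_brK_three, shuffle_brK_four,
    shuffle_brK_five, shuffle_brK_six, eB_five_sort₀, eB_five_sort₁, eB_five_sort₂,
    eB_five_sort₃, eB_five_eq_zero₀, eB_five_eq_zero₁, eB_five_eq_zero₂, eB_five_eq_zero₃]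
  field_simp
  ring

end G2Solitons
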